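/- Let (b,c) be a connected graph over a countably infinite set X. Then the following are equivalent: (i) (b,c) is canonically compactifiable, i.e. every function of finite energy is bounded; (ii) (b,c) is uniformly transient and every harmonic function of finite energy is bounded. -/

import Mathlib

open ENNReal Filter Topology

namespace UTGraph

variable {X : Type*}

/-- A graph over `X`: symmetric nonnegative edge weight `b` with zero diagonal and
summable rows, together with a nonnegative potential (killing term) `c`. -/
structure IsGraph (b : X → X → ℝ) (c : X → ℝ) : Prop where
  symm : ∀ x y, b x y = b y x
  nonneg : ∀ x y, 0 ≤ b x y
  loopless : ∀ x, b x x = 0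
  row_summable : ∀ x, Summable fun y => b x y
  c_nonneg : ∀ x, 0 ≤ c x

/-- Connectedness: any two vertices are joined by a path of positive edge weights. -/
def Connected (b : X → X → ℝ) : Prop :=
  ∀ x y : X, Relation.ReflTransGen (fun u v => 0 < b u v) x y

/-- The energy form `Q(f)`, with values in `[0,∞]`. -/
noncomputable def energy (b : X → X → ℝ) (c : X → ℝ) (f : X → ℝ) : ℝ≥0∞ :=
  (1 / 2) * ∑' p : X × X, ENNReal.ofReal (b p.1 p.2 * (f p.1 - f p.2) ^ 2)
    + ∑' x, ENNReal.ofReal (c x * f x ^ 2)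

/-- `f` has finite energy, i.e. `f ∈ D`. -/
def FiniteEnergy (b : X → X → ℝ) (c : X → ℝ) (f : X → ℝ) : Prop :=
  energy b c f < ⊤

/-- The bilinear energy form `Q(f,g)` (for finite-energy functions). -/
noncomputable def energyBilin (b : X → X → ℝ) (c : X → ℝ) (f g : X → ℝ) : ℝ :=
  (1 / 2) * ∑' p : X × X, b p.1 p.2 * (f p.1 - f p.2) * (g p.1 - g p.2)
    + ∑' x, c x * f x * g x

/-- `f ∈ C_c(X)`: finitely supported function. -/
def FinSupp (f : X → ℝ) : Prop := (Function.support f).Finite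

/-- The norm `‖f‖_o = (Q(f) + f(o)²)^{1/2}`. -/
noncomputable def normO (b : X → X → ℝ) (c : X → ℝ) (o : X) (f : X → ℝ) : ℝ :=
  Real.sqrt ((energy b c f).toReal + f o ^ 2)

/-- `f ∈ D₀`: there is a sequence of finitely supported functions converging to `f`
pointwise whose energy difference to `f` tends to `0`. -/
def MemD0 (b : X → X → ℝ) (c : X → ℝ) (f : X → ℝ) : Prop :=
  ∃ φ : ℕ → X → ℝ, (∀ n, FinSupp (φ n)) ∧
    (∀ x, Tendsto (fun n => φ n x) atTop (𝓝 (f x))) ∧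
    Tendsto (fun n => energy b c (φ n - f)) atTop (𝓝 0)

/-- `f ∈ C₀(X)`: `f` belongs to the uniform closure of the finitely supported functions,
i.e. for every `ε > 0` the set where `|f| ≥ ε` is finite. -/
def MemC0 (f : X → ℝ) : Prop := ∀ ε : ℝ, 0 < ε → {x | ε ≤ |f x|}.Finite

/-- The graph is uniformly transient: `D₀ ⊆ C₀(X)`. -/
def UniformlyTransient (b : X → X → ℝ) (c : X → ℝ) : Prop :=
  ∀ f : X → ℝ, MemD0 b c f → MemC0 f

/-- The capacity of a point: `cap(x) = inf {Q(φ) : φ ∈ C_c(X), φ(x) = 1}`. -/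
noncomputable def cap (b : X → X → ℝ) (c : X → ℝ) (x : X) : ℝ≥0∞ :=
  ⨅ (φ : X → ℝ) (_ : FinSupp φ) (_ : φ x = 1), energy b c φ

/-- `f ∈ F`: the domain of the formal Laplacian. -/
def MemF (b : X → X → ℝ) (f : X → ℝ) : Prop :=
  ∀ x, Summable fun y => b x y * |f y|

/-- The formal Laplacian `𝓛 f (x) = Σ_y b(x,y)(f(x) - f(y)) + c(x) f(x)`. -/
noncomputable def formalLaplacian (b : X → X → ℝ) (c : X → ℝ) (f : X → ℝ) (x : X) : ℝ :=
  (∑' y, b x y * (f x - f y)) + c x * f x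

/-- `f` is harmonic: `f ∈ F` and `𝓛 f = 0`. -/
def Harmonic (b : X → X → ℝ) (c : X → ℝ) (f : X → ℝ) : Prop :=
  MemF b f ∧ ∀ x, formalLaplacian b c f x = 0

/-- The graph is recurrent: the constant function `1` lies in `D₀` and `Q(1) = 0`. -/
def Recurrent (b : X → X → ℝ) (c : X → ℝ) : Prop :=
  MemD0 b c 1 ∧ energy b c 1 = 0

/-- The graph is transient: not recurrent. -/
def Transient (b : X → X → ℝ) (c : X → ℝ) : Prop := ¬ Recurrent b c

/-- The metric `γ_o`. -/
noncomputable def gammaO (b : X → X → ℝ) (c : X → ℝ) (o x y : X) : ℝ :=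
  sSup {d : ℝ | ∃ φ : X → ℝ, FinSupp φ ∧
    energy b c φ + ENNReal.ofReal (φ o ^ 2) ≤ 1 ∧ d = |φ x - φ y|}

/-- The metric `γ`. -/
noncomputable def gamma (b : X → X → ℝ) (c : X → ℝ) (x y : X) : ℝ :=
  sSup {d : ℝ | ∃ φ : X → ℝ, FinSupp φ ∧ energy b c φ ≤ 1 ∧ d = |φ x - φ y|}

/-- `d` is a metric on `X`. -/
def IsMetric (d : X → X → ℝ) : Prop :=
  (∀ x y, 0 ≤ d x y) ∧ (∀ x y, d x y = d y x) ∧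
  (∀ x y, d x y = 0 ↔ x = y) ∧ (∀ x y z, d x z ≤ d x y + d y z)

/-- `f` belongs to the closure of `C_c(X)` with respect to the norm
`‖·‖_Q = (Q(·) + ‖·‖_m²)^{1/2}` inside `D ∩ ℓ²(X,m)`. -/
def MemFormDomain (b : X → X → ℝ) (c : X → ℝ) (m : X → ℝ) (f : X → ℝ) : Prop :=
  FiniteEnergy b c f ∧ Summable (fun x => m x * f x ^ 2) ∧
  ∃ φ : ℕ → X → ℝ, (∀ n, FinSupp (φ n)) ∧
    Tendsto (fun n => energy b c (f - φ n)
      + ∑' x, ENNReal.ofReal (m x * (f x - φ n x) ^ 2)) atTop (𝓝 0)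

end UTGraph

namespace UTGraph

section

variable {X : Type*} {b : X → X → ℝ} {c : X → ℝ}

/-- The weights of the energy form, indexed by pairs of vertices and by vertices. -/
noncomputable def energyWeight (b : X → X → ℝ) (c : X → ℝ) : (X × X) ⊕ X → ℝ :=
  Sum.elim (fun p => b p.1 p.2 / 2) c

/-- The differences of `f` along pairs of vertices, together with its values. -/
def increment (f : X → ℝ) : (X × X) ⊕ X → ℝ :=
  Sum.elim (fun p => f p.1 - f p.2) f

lemma increment_add (f g : X → ℝ) (i : (X × X) ⊕ X) :
    increment (f + g) i = increment f i + increment g i := by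
  rcases i with p | x <;> simp [increment]; ring

lemma increment_sub (f g : X → ℝ) (i : (X × X) ⊕ X) :
    increment (f - g) i = increment f i - increment g i := by
  rcases i with p | x <;> simp [increment]; ring

lemma increment_smul (t : ℝ) (f : X → ℝ) (i : (X × X) ⊕ X) :
    increment (t • f) i = t * increment f i := by
  rcases i with p | x <;> simp [increment]; ring

lemma continuous_increment (i : (X × X) ⊕ X) :
    Continuous fun f : X → ℝ => increment f i := by
  rcases i with p | x <;> simp only [increment, Sum.elim_inl, Sum.elim_inr] <;> fun_prop

lemma IsGraph.energyWeight_nonneg (hG : IsGraph b c) (i : (X × X) ⊕ X) :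
    0 ≤ energyWeight b c i := by
  rcases i with p | x
  · exact div_nonneg (hG.nonneg _ _) two_pos.le
  · exact hG.c_nonneg x

lemma energy_eq_tsum (b : X → X → ℝ) (c f : X → ℝ) :
    energy b c f = ∑' i, ENNReal.ofReal (energyWeight b c i * increment f i ^ 2) := by
  rw [Summable.tsum_sum ENNReal.summable ENNReal.summable, energy, ← ENNReal.tsum_mul_left]
  congr 1
  refine tsum_congr fun p => ?_
  have h : energyWeight b c (Sum.inl p) * increment f (Sum.inl p) ^ 2
      = 1 / 2 * (b p.1 p.2 * (f p.1 - f p.2) ^ 2) := by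
    simp only [energyWeight, increment, Sum.elim_inl]; ring
  rw [h, ENNReal.ofReal_mul (p := 1 / 2) (by norm_num), ENNReal.ofReal_div_of_pos two_pos]
  simp

lemma ofReal_le_energy (f : X → ℝ) (i : (X × X) ⊕ X) :
    ENNReal.ofReal (energyWeight b c i * increment f i ^ 2) ≤ energy b c f := by
  rw [energy_eq_tsum]
  exact ENNReal.le_tsum i

lemma energy_smul (t : ℝ) (f : X → ℝ) :
    energy b c (t • f) = ENNReal.ofReal (t ^ 2) * energy b c f := by
  simp only [energy_eq_tsum, ← ENNReal.tsum_mul_left]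
  refine tsum_congr fun i => ?_
  rw [← ENNReal.ofReal_mul (sq_nonneg t), increment_smul]
  congr 1
  ring

lemma energy_sub_comm (f g : X → ℝ) : energy b c (f - g) = energy b c (g - f) := by
  have h := energy_smul (b := b) (c := c) (-1) (g - f)
  simpa using h

lemma IsGraph.energy_parallelogram (hG : IsGraph b c) (f g : X → ℝ) :
    energy b c (f + g) + energy b c (f - g) = 2 * energy b c f + 2 * energy b c g := by
  simp only [energy_eq_tsum, ← ENNReal.tsum_mul_left, ← ENNReal.tsum_add]
  refine tsum_congr fun i => ?_
  have hw := hG.energyWeight_nonneg i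
  have h2 : (2 : ℝ≥0∞) = ENNReal.ofReal 2 := by simp
  rw [h2, ← ENNReal.ofReal_mul two_pos.le, ← ENNReal.ofReal_mul two_pos.le,
    ← ENNReal.ofReal_add (by positivity) (by positivity),
    ← ENNReal.ofReal_add (by positivity) (by positivity), increment_add, increment_sub]
  congr 1
  ring

lemma IsGraph.energy_add_le (hG : IsGraph b c) (f g : X → ℝ) {ε : ℝ} (hε : 0 < ε) :
    energy b c (f + g) ≤ ENNReal.ofReal (1 + ε) * energy b c f
      + ENNReal.ofReal (1 + ε⁻¹) * energy b c g := by
  simp only [energy_eq_tsum, ← ENNReal.tsum_mul_left, ← ENNReal.tsum_add]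
  refine ENNReal.tsum_le_tsum fun i => ?_
  have hw := hG.energyWeight_nonneg i
  rw [← ENNReal.ofReal_mul (by positivity), ← ENNReal.ofReal_mul (by positivity),
    ← ENNReal.ofReal_add (by positivity) (by positivity), increment_add]
  refine ENNReal.ofReal_le_ofReal ?_
  set u := increment f i
  set v := increment g i
  have h : (1 + ε) * u ^ 2 + (1 + ε⁻¹) * v ^ 2 - (u + v) ^ 2 = ε⁻¹ * (ε * u - v) ^ 2 := by
    field_simp; ring
  have h' : 0 ≤ ε⁻¹ * (ε * u - v) ^ 2 := by positivity
  nlinarith [mul_nonneg hw (h ▸ h')]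

lemma lowerSemicontinuous_energy (b : X → X → ℝ) (c : X → ℝ) :
    LowerSemicontinuous fun f : X → ℝ => energy b c f := by
  simp only [energy_eq_tsum]
  refine lowerSemicontinuous_tsum fun i => Continuous.lowerSemicontinuous ?_
  exact ENNReal.continuous_ofReal.comp (continuous_const.mul ((continuous_increment i).pow 2))

lemma energy_le_of_tendsto {g : ℕ → X → ℝ} {f : X → ℝ} {K : ℝ≥0∞}
    (hlim : ∀ x, Tendsto (fun n => g n x) atTop (𝓝 (f x)))
    (hK : ∀ᶠ n in atTop, energy b c (g n) ≤ K) : energy b c f ≤ K :=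
  ((lowerSemicontinuous_energy b c).isClosed_preimage K).mem_of_tendsto
    (tendsto_pi_nhds.2 hlim) hK

lemma abs_increment_iSup_abs_le {g : ℕ → X → ℝ}
    (hbdd : ∀ x, BddAbove (Set.range fun n => |g n x|)) (i : (X × X) ⊕ X) {K : ℝ}
    (hK : ∀ n, |increment (g n) i| ≤ K) :
    |increment (fun x => ⨆ n, |g n x|) i| ≤ K := by
  have key : ∀ x y, (∀ n, |g n x - g n y| ≤ K) → (⨆ n, |g n x|) ≤ (⨆ n, |g n y|) + K := by
    intro x y h
    refine ciSup_le fun n => ?_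
    have h1 := le_ciSup (hbdd y) n
    have h2 := abs_sub_abs_le_abs_sub (g n x) (g n y)
    linarith [h n]
  rcases i with p | x
  · simp only [increment, Sum.elim_inl] at hK ⊢
    have h1 := key p.1 p.2 hK
    have h2 := key p.2 p.1 fun n => by rw [abs_sub_comm]; exact hK n
    rw [abs_le]
    constructor <;> linarith
  · simp only [increment, Sum.elim_inr] at hK ⊢
    rw [abs_of_nonneg (Real.iSup_nonneg fun n => abs_nonneg _)]
    exact ciSup_le hK

lemma IsGraph.energy_iSup_abs_le (hG : IsGraph b c) {g : ℕ → X → ℝ}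
    (hbdd : ∀ x, BddAbove (Set.range fun n => |g n x|)) :
    energy b c (fun x => ⨆ n, |g n x|) ≤ ∑' n, energy b c (g n) := by
  simp only [energy_eq_tsum]
  rw [ENNReal.tsum_comm]
  refine ENNReal.tsum_le_tsum fun i => ?_
  set T := ∑' n, ENNReal.ofReal (energyWeight b c i * increment (g n) i ^ 2) with hT
  rcases eq_or_ne T ⊤ with h | h
  · simp [h]
  rcases (hG.energyWeight_nonneg i).eq_or_lt with hw | hw
  · simp [← hw]
  have hle : ∀ n, |increment (g n) i| ≤ √(T.toReal / energyWeight b c i) := by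
    intro n
    refine Real.abs_le_sqrt ?_
    rw [le_div_iff₀ hw, mul_comm]
    exact (ENNReal.ofReal_le_iff_le_toReal h).1 (ENNReal.le_tsum n)
  have hsup := abs_increment_iSup_abs_le hbdd i hle
  rw [ENNReal.ofReal_le_iff_le_toReal h, mul_comm, ← le_div_iff₀ hw, ← sq_abs]
  have hnn : 0 ≤ T.toReal / energyWeight b c i := by positivity
  calc _ ≤ √(T.toReal / energyWeight b c i) ^ 2 := by gcongr
    _ = _ := Real.sq_sqrt hnn

lemma Connected.exists_sub_sq_le (hconn : Connected b) (c : X → ℝ) (x y : X) :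
    ∃ C : ℝ, 0 ≤ C ∧ ∀ (f : X → ℝ) (K : ℝ), 0 ≤ K → energy b c f ≤ ENNReal.ofReal K →
      (f x - f y) ^ 2 ≤ C * K := by
  induction hconn x y with
  | refl => exact ⟨0, le_rfl, by simp⟩
  | @tail u v _ huv ih =>
    obtain ⟨C, hC, hle⟩ := ih
    refine ⟨2 * C + 4 / b u v, by positivity, fun f K hK hf => ?_⟩
    have h1 := hle f K hK hf
    have h2 := (ENNReal.ofReal_le_ofReal_iff hK).1
      ((ofReal_le_energy f (Sum.inl (u, v))).trans hf)
    simp only [energyWeight, increment, Sum.elim_inl] at h2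
    have h3 : (f u - f v) ^ 2 ≤ 2 / b u v * K := by
      rw [div_mul_eq_mul_div, le_div_iff₀ huv]
      linarith
    have h4 : (2 * C + 4 / b u v) * K = 2 * (C * K) + 2 * (2 / b u v * K) := by ring
    rw [h4]
    nlinarith [sq_nonneg ((f x - f u) - (f u - f v))]

lemma IsGraph.uniformlyTransient_of_bounded [Nonempty X] (hG : IsGraph b c) (hconn : Connected b)
    (hbd : ∀ f : X → ℝ, FiniteEnergy b c f → ∃ M : ℝ, ∀ x, |f x| ≤ M) :
    UniformlyTransient b c := by
  rintro f ⟨φ, hφ, hlim, hE⟩ ε hε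
  obtain ⟨o⟩ := ‹Nonempty X›
  have hev : ∀ n : ℕ, ∀ᶠ k in atTop,
      energy b c (((n : ℝ) + 1) • (φ k - f)) ≤ ENNReal.ofReal ((1 / 2) ^ n) ∧
        |((n : ℝ) + 1) * (φ k o - f o)| ≤ 1 := by
    intro n
    refine Eventually.and ?_ ?_
    · simp only [energy_smul]
      have h := ENNReal.Tendsto.const_mul (a := ENNReal.ofReal (((n : ℝ) + 1) ^ 2)) hE
        (Or.inr ENNReal.ofReal_ne_top)
      rw [mul_zero] at h
      exact h.eventually_le_const (by positivity)
    · have h := ((hlim o).sub_const (f o)).const_mul ((n : ℝ) + 1) |>.abs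
      rw [sub_self, mul_zero, abs_zero] at h
      exact h.eventually_le_const one_pos
  choose k hk using fun n => (hev n).exists
  set g : ℕ → X → ℝ := fun n => ((n : ℝ) + 1) • (φ (k n) - f) with hg
  have hbdd : ∀ x, BddAbove (Set.range fun n => |g n x|) := by
    intro x
    obtain ⟨C, -, hle⟩ := hconn.exists_sub_sq_le c x o
    refine ⟨√C + 1, ?_⟩
    rintro _ ⟨n, rfl⟩
    have h1 := hle (g n) 1 one_pos.le
      ((hk n).1.trans (ENNReal.ofReal_le_ofReal (pow_le_one₀ (by norm_num) (by norm_num))))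
    rw [mul_one] at h1
    have h2 : |g n o| ≤ 1 := by simpa [hg] using (hk n).2
    have h3 := Real.abs_le_sqrt h1
    have h4 := abs_sub_abs_le_abs_sub (g n x) (g n o)
    dsimp only
    linarith
  have hfin : FiniteEnergy b c fun x => ⨆ n, |g n x| := by
    refine (hG.energy_iSup_abs_le hbdd).trans_lt ?_
    refine (ENNReal.tsum_le_tsum fun n => (hk n).1).trans_lt ?_
    exact summable_geometric_two.tsum_ofReal_lt_top
  obtain ⟨M, hM⟩ := hbd _ hfin
  obtain ⟨n, hn⟩ := exists_nat_gt (M / ε)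
  refine (hφ (k n)).subset fun x hx => ?_
  by_contra hsupp
  have h0 : φ (k n) x = 0 := by simpa using hsupp
  have h1 : |g n x| ≤ M := ((le_ciSup (hbdd x) n).trans (le_abs_self _)).trans (hM x)
  have h2 : |g n x| = ((n : ℝ) + 1) * |f x| := by
    simp only [hg, Pi.smul_apply, Pi.sub_apply, h0, smul_eq_mul, abs_mul, zero_sub, abs_neg]
    rw [abs_of_pos (by positivity : (0 : ℝ) < n + 1)]
  have h3 : M < n * ε := (div_lt_iff₀ hε).1 hn
  have h4 : ε ≤ |f x| := hx
  have h5 : ((n : ℝ) + 1) * ε ≤ (n + 1) * |f x| := by gcongr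
  nlinarith

lemma IsGraph.exists_sq_le_of_uniformlyTransient [Infinite X] (hG : IsGraph b c)
    (hconn : Connected b) (hUT : UniformlyTransient b c) (o : X) :
    ∃ C : ℝ, 0 ≤ C ∧ ∀ (φ : X → ℝ) (K : ℝ), FinSupp φ → 0 ≤ K →
      energy b c φ ≤ ENNReal.ofReal K → φ o ^ 2 ≤ C * K := by
  by_contra! hcon
  choose φ K hφ hK hE hlt using fun n : ℕ => hcon (n + 1) (by positivity)
  have hpos : ∀ n, 0 < φ n o ^ 2 := fun n =>
    (mul_nonneg (by positivity : (0 : ℝ) ≤ n + 1) (hK n)).trans_lt (hlt n)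
  set ψ : ℕ → X → ℝ := fun n => (φ n o)⁻¹ • φ n with hψ
  have hψo : ∀ n, ψ n o = 1 := fun n =>
    inv_mul_cancel₀ fun h => (hpos n).ne' (by simp [h])
  have hψE : ∀ n : ℕ, energy b c (ψ n) ≤ ENNReal.ofReal (1 / ((n : ℝ) + 1)) := by
    intro n
    rw [hψ, energy_smul]
    calc _ ≤ ENNReal.ofReal ((φ n o)⁻¹ ^ 2) * ENNReal.ofReal (K n) := by gcongr; exact hE n
      _ = ENNReal.ofReal ((φ n o)⁻¹ ^ 2 * K n) := (ENNReal.ofReal_mul (sq_nonneg _)).symm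
      _ ≤ _ := by
        refine ENNReal.ofReal_le_ofReal ?_
        rw [inv_pow, inv_mul_eq_div, div_le_div_iff₀ (hpos n) (by positivity)]
        linarith [hlt n]
  have htend : Tendsto (fun n : ℕ => ENNReal.ofReal (1 / ((n : ℝ) + 1))) atTop (𝓝 0) := by
    simpa using ENNReal.tendsto_ofReal (tendsto_one_div_add_atTop_nhds_zero_nat (𝕜 := ℝ))
  have hψE0 : Tendsto (fun n => energy b c (ψ n)) atTop (𝓝 0) :=
    tendsto_of_tendsto_of_tendsto_of_le_of_le tendsto_const_nhds htend (fun _ => zero_le) hψE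
  have hlim : ∀ x, Tendsto (fun n => ψ n x) atTop (𝓝 ((1 : X → ℝ) x)) := by
    intro x
    obtain ⟨C, -, hle⟩ := hconn.exists_sub_sq_le c x o
    have h : ∀ n : ℕ, |ψ n x - 1| ≤ √(C * (1 / ((n : ℝ) + 1))) := fun n => by
      refine Real.abs_le_sqrt ?_
      simpa [hψo] using hle (ψ n) (1 / ((n : ℝ) + 1)) (by positivity) (hψE n)
    have ht : Tendsto (fun n : ℕ => √(C * (1 / ((n : ℝ) + 1)))) atTop (𝓝 0) := by
      simpa using (tendsto_one_div_add_atTop_nhds_zero_nat (𝕜 := ℝ)).const_mul C |>.sqrt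
    rw [tendsto_iff_dist_tendsto_zero]
    exact squeeze_zero (fun _ => dist_nonneg) h ht
  have hone : energy b c 1 = 0 :=
    le_zero_iff.1 <| le_of_forall_gt_imp_ge_of_dense fun δ hδ =>
      energy_le_of_tendsto hlim (hψE0.eventually_le_const hδ)
  have hmem : MemD0 b c 1 := by
    refine ⟨ψ, fun n => (hφ n).subset (Function.support_const_smul_subset _ _), hlim, ?_⟩
    refine tendsto_of_tendsto_of_tendsto_of_le_of_le tendsto_const_nhds
      (by simpa using ENNReal.Tendsto.const_mul (a := 2) hψE0 (by simp)) (fun _ => zero_le)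
      fun n => ?_
    have h := hG.energy_parallelogram (ψ n) 1
    rw [hone, mul_zero, add_zero] at h
    exact le_add_self.trans h.le
  refine Set.infinite_univ (α := X) ((hUT 1 hmem 1 one_pos).subset fun x _ => ?_)
  simp

lemma FiniteEnergy.summable (hG : IsGraph b c) {f : X → ℝ} (hf : FiniteEnergy b c f) :
    Summable fun i => energyWeight b c i * increment f i ^ 2 := by
  rw [FiniteEnergy, energy_eq_tsum] at hf
  refine (ENNReal.summable_toReal hf.ne).congr fun i => ENNReal.toReal_ofReal ?_
  have := hG.energyWeight_nonneg i
  positivity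

lemma IsGraph.energy_eq_ofReal_of_hasSum (hG : IsGraph b c) {f : X → ℝ} {s : ℝ}
    (hs : HasSum (fun i => energyWeight b c i * increment f i ^ 2) s) :
    energy b c f = ENNReal.ofReal s := by
  rw [energy_eq_tsum, ← hs.tsum_eq, ENNReal.ofReal_tsum_of_nonneg _ hs.summable]
  intro i
  have := hG.energyWeight_nonneg i
  positivity

lemma FiniteEnergy.summable_abs_row (hG : IsGraph b c) {f : X → ℝ} (hf : FiniteEnergy b c f)
    (x : X) : Summable fun y => b x y * |f x - f y| := by
  have hinj : Function.Injective fun y : X => (Sum.inl (x, y) : (X × X) ⊕ X) := fun y z h => by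
    simpa using h
  have h1 := ((hf.summable hG).comp_injective hinj).mul_left 2
  refine Summable.of_nonneg_of_le (fun y => mul_nonneg (hG.nonneg x y) (abs_nonneg _))
    (fun y => ?_) ((hG.row_summable x).add h1)
  have hb := hG.nonneg x y
  simp only [Function.comp, energyWeight, increment, Sum.elim_inl]
  rw [← sq_abs (f x - f y)]
  nlinarith [mul_nonneg hb (sq_nonneg (|f x - f y| - 1)), mul_nonneg hb (abs_nonneg (f x - f y)),
    mul_nonneg hb (sq_nonneg (|f x - f y|))]

open Classical in
/-- The Green formula against the indicator of a point. -/
lemma IsGraph.hasSum_increment_single (hG : IsGraph b c) {f : X → ℝ} {x : X}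
    (hf : Summable fun y => b x y * (f x - f y)) :
    HasSum (fun i => energyWeight b c i * increment f i * increment (Pi.single x (1 : ℝ)) i)
      (formalLaplacian b c f x) := by
  refine HasSum.sum ?_ ?_
  · set u : X × X → ℝ := fun p =>
      b p.1 p.2 / 2 * (f p.1 - f p.2) * (Pi.single x 1 : X → ℝ) p.1 with hu
    have hinj : Function.Injective fun y : X => (x, y) := fun y z h => by simpa using h
    have h1 : HasSum u ((∑' y, b x y * (f x - f y)) / 2) := by
      refine (hinj.hasSum_iff fun p hp => ?_).1 ?_
      · have hne : p.1 ≠ x := fun h => hp ⟨p.2, by simp [← h]⟩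
        simp [hu, Pi.single_eq_of_ne hne]
      · refine (hf.hasSum.div_const 2).congr_fun ?_
        intro y
        simp only [Function.comp, hu, Pi.single_eq_same]
        ring
    have h2 : HasSum (u ∘ Prod.swap) ((∑' y, b x y * (f x - f y)) / 2) :=
      (Equiv.prodComm X X).hasSum_iff.2 h1
    have h3 := h1.add h2
    rw [add_halves] at h3
    refine h3.congr_fun fun p => ?_
    simp only [Function.comp, hu, energyWeight, increment, Sum.elim_inl, Prod.fst_swap,
      Prod.snd_swap, hG.symm p.2 p.1]
    ring
  · convert hasSum_single x ?_ using 1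
    · simp [energyWeight, increment]
    · intro y hy
      simp [increment, Pi.single_eq_of_ne hy]

open Classical in
lemma IsGraph.formalLaplacian_eq_zero_of_forall_energy_le (hG : IsGraph b c) {h : X → ℝ}
    (hh : FiniteEnergy b c h)
    (hmin : ∀ φ : X → ℝ, FinSupp φ → energy b c h ≤ energy b c (h + φ)) (x : X) :
    formalLaplacian b c h x = 0 := by
  set δ : X → ℝ := Pi.single x 1 with hδ
  have hrow : Summable fun y => b x y * (h x - h y) := by
    refine Summable.of_abs ((hh.summable_abs_row hG x).congr fun y => ?_)
    rw [abs_mul, abs_of_nonneg (hG.nonneg x y)]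
  have hrowδ : Summable fun y => b x y * (δ x - δ y) := by
    refine (hG.row_summable x).congr fun y => ?_
    rcases eq_or_ne y x with rfl | hy
    · simp [hG.loopless]
    · simp [hδ, Pi.single_eq_of_ne hy]
  have hcross := hG.hasSum_increment_single hrow
  have hsq := hG.hasSum_increment_single hrowδ
  set L := formalLaplacian b c h x
  set K := formalLaplacian b c δ x
  obtain ⟨A, hA⟩ := hh.summable hG
  have hK : 0 ≤ K := hsq.nonneg fun i => by
    rw [mul_assoc]
    exact mul_nonneg (hG.energyWeight_nonneg i) (mul_self_nonneg _)
  have hA0 : 0 ≤ A := hA.nonneg fun i => mul_nonneg (hG.energyWeight_nonneg i) (sq_nonneg _)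
  have hexp : ∀ t : ℝ, HasSum (fun i => energyWeight b c i * increment (h + t • δ) i ^ 2)
      (A + 2 * t * L + t ^ 2 * K) := by
    intro t
    refine ((hA.add (hcross.mul_left (2 * t))).add (hsq.mul_left (t ^ 2))).congr_fun fun i => ?_
    rw [increment_add, increment_smul]
    ring
  have hle : ∀ t : ℝ, 0 ≤ 2 * t * L + t ^ 2 * K := by
    intro t
    have hfs : FinSupp (t • δ) := by
      refine (Set.finite_singleton x).subset fun y hy => ?_
      by_contra hne
      exact hy (by simp [hδ, Pi.single_eq_of_ne (Set.mem_singleton_iff.not.1 hne)])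
    have hm := hmin _ hfs
    rw [hG.energy_eq_ofReal_of_hasSum hA, hG.energy_eq_ofReal_of_hasSum (hexp t),
      ENNReal.ofReal_le_ofReal_iff ((hexp t).nonneg fun i =>
        mul_nonneg (hG.energyWeight_nonneg i) (sq_nonneg _))] at hm
    linarith
  have h1 := hle (-L / (K + 1))
  have h2 : 2 * (-L / (K + 1)) * L + (-L / (K + 1)) ^ 2 * K
      = -(L ^ 2 * ((K + 2) / (K + 1) ^ 2)) := by
    field_simp; ring
  rw [h2] at h1
  have h3 : 0 < (K + 2) / (K + 1) ^ 2 := by positivity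
  have h4 : L ^ 2 ≤ 0 := by
    by_contra! hpos
    linarith [mul_pos hpos h3]
  exact pow_eq_zero_iff two_ne_zero |>.1 (le_antisymm h4 (sq_nonneg L))

lemma FiniteEnergy.memF (hG : IsGraph b c) {f : X → ℝ} (hf : FiniteEnergy b c f) :
    MemF b f := by
  intro x
  refine Summable.of_nonneg_of_le (fun y => mul_nonneg (hG.nonneg x y) (abs_nonneg _))
    (fun y => ?_) (((hG.row_summable x).mul_right |f x|).add (hf.summable_abs_row hG x))
  rw [← mul_add]
  refine mul_le_mul_of_nonneg_left ?_ (hG.nonneg x y)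
  have := abs_sub_abs_le_abs_sub (f y) (f x)
  rw [abs_sub_comm] at this
  linarith

lemma IsGraph.exists_minimizing_seq (hG : IsGraph b c) {f : X → ℝ} (hf : FiniteEnergy b c f) :
    ∃ (d : ℝ) (φ : ℕ → X → ℝ), (∀ n, FinSupp (φ n)) ∧
      (∀ ψ, FinSupp ψ → ENNReal.ofReal d ≤ energy b c (f - ψ)) ∧
      (∀ n : ℕ, energy b c (f - φ n) ≤ ENNReal.ofReal (d + 1 / ((n : ℝ) + 1))) ∧
      ∀ m n : ℕ, energy b c (φ m - φ n) ≤
        ENNReal.ofReal (2 / ((m : ℝ) + 1) + 2 / ((n : ℝ) + 1)) := by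
  set I : ℝ≥0∞ := ⨅ ψ : {ψ : X → ℝ // FinSupp ψ}, energy b c (f - ψ.1) with hI
  have hle : ∀ ψ, FinSupp ψ → I ≤ energy b c (f - ψ) := fun ψ hψ => iInf_le_of_le ⟨ψ, hψ⟩ le_rfl
  have hzero : FinSupp (0 : X → ℝ) := by simp [FinSupp]
  have htop : I ≠ ⊤ := ((hle 0 hzero).trans_lt (by rw [sub_zero]; exact hf)).ne
  have hId : ENNReal.ofReal I.toReal = I := ENNReal.ofReal_toReal htop
  have hex : ∀ n : ℕ, ∃ ψ : X → ℝ, FinSupp ψ ∧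
      energy b c (f - ψ) ≤ ENNReal.ofReal (I.toReal + 1 / ((n : ℝ) + 1)) := by
    intro n
    have hlt : I < ENNReal.ofReal (I.toReal + 1 / ((n : ℝ) + 1)) := by
      rw [← ENNReal.toReal_lt_toReal htop ENNReal.ofReal_ne_top,
        ENNReal.toReal_ofReal (by positivity)]
      have : 0 < 1 / ((n : ℝ) + 1) := by positivity
      linarith
    obtain ⟨⟨ψ, hψ⟩, h⟩ := iInf_lt_iff.1 hlt
    exact ⟨ψ, hψ, h.le⟩
  choose φ hφ hE using hex
  refine ⟨I.toReal, φ, hφ, fun ψ hψ => hId.le.trans (hle ψ hψ), hE, fun m n => ?_⟩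
  set d := I.toReal
  have hd : 0 ≤ d := ENNReal.toReal_nonneg
  have hmid : FinSupp ((1 / 2 : ℝ) • (φ m + φ n)) :=
    (((hφ m).union (hφ n)).subset (Function.support_add _ _)).subset
      (Function.support_const_smul_subset _ _)
  have hsum : (f - φ m) + (f - φ n) = (2 : ℝ) • (f - (1 / 2 : ℝ) • (φ m + φ n)) := by
    ext x
    simp only [Pi.add_apply, Pi.sub_apply, Pi.smul_apply, smul_eq_mul]
    ring
  have hlow : ENNReal.ofReal (4 * d) ≤ energy b c ((f - φ m) + (f - φ n)) := by
    rw [hsum, energy_smul, show (2 : ℝ) ^ 2 = 4 by norm_num, ENNReal.ofReal_mul (by norm_num)]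
    gcongr
    exact hId.le.trans (hle _ hmid)
  have hpar := hG.energy_parallelogram (f - φ m) (f - φ n)
  have hdiff : (f - φ m) - (f - φ n) = φ n - φ m := by abel
  rw [hdiff, energy_sub_comm (φ n)] at hpar
  have h2 : (2 : ℝ≥0∞) = ENNReal.ofReal 2 := by simp
  refine (ENNReal.add_le_add_iff_left (ENNReal.ofReal_ne_top (r := 4 * d))).1 ?_
  calc _ ≤ energy b c ((f - φ m) + (f - φ n)) + energy b c (φ m - φ n) := by gcongr
    _ = 2 * energy b c (f - φ m) + 2 * energy b c (f - φ n) := hpar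
    _ ≤ 2 * ENNReal.ofReal (d + 1 / ((m : ℝ) + 1))
        + 2 * ENNReal.ofReal (d + 1 / ((n : ℝ) + 1)) := by gcongr <;> apply hE
    _ = _ := by
      rw [h2, ← ENNReal.ofReal_mul two_pos.le, ← ENNReal.ofReal_mul two_pos.le,
        ← ENNReal.ofReal_add (by positivity) (by positivity),
        ← ENNReal.ofReal_add (by positivity) (by positivity)]
      congr 1
      ring

/-- Royden decomposition: over a uniformly transient graph, every function of finite energy
differs from a harmonic function of finite energy by an element of `D₀`. -/
lemma IsGraph.exists_royden_decomposition [Infinite X] (hG : IsGraph b c) (hconn : Connected b)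
    (hUT : UniformlyTransient b c) {f : X → ℝ} (hf : FiniteEnergy b c f) :
    ∃ g : X → ℝ, MemD0 b c g ∧ FiniteEnergy b c (f - g) ∧ Harmonic b c (f - g) := by
  obtain ⟨d, φ, hφ, hlow, hup, hcau⟩ := hG.exists_minimizing_seq hf
  have hbound : ∀ m n N : ℕ, N ≤ m → N ≤ n →
      energy b c (φ m - φ n) ≤ ENNReal.ofReal (4 * (1 / ((N : ℝ) + 1))) := by
    intro m n N hm hn
    refine (hcau m n).trans (ENNReal.ofReal_le_ofReal ?_)
    have h1 : 2 / ((m : ℝ) + 1) ≤ 2 / ((N : ℝ) + 1) := by gcongr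
    have h2 : 2 / ((n : ℝ) + 1) ≤ 2 / ((N : ℝ) + 1) := by gcongr
    have h3 : 4 * (1 / ((N : ℝ) + 1)) = 2 / ((N : ℝ) + 1) + 2 / ((N : ℝ) + 1) := by ring
    linarith
  have hlim1 : Tendsto (fun n : ℕ => 1 / ((n : ℝ) + 1)) atTop (𝓝 0) :=
    tendsto_one_div_add_atTop_nhds_zero_nat
  have hlim4 : Tendsto (fun n : ℕ => 4 * (1 / ((n : ℝ) + 1))) atTop (𝓝 0) := by
    simpa only [mul_zero] using hlim1.const_mul 4
  have hconv : ∀ x, ∃ a, Tendsto (fun n => φ n x) atTop (𝓝 a) := by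
    intro x
    obtain ⟨C, -, hC⟩ := hG.exists_sq_le_of_uniformlyTransient hconn hUT x
    refine cauchySeq_tendsto_of_complete
      (cauchySeq_of_le_tendsto_0 (fun N : ℕ => √(C * (4 * (1 / ((N : ℝ) + 1))))) ?_ ?_)
    · intro m n N hm hn
      refine Real.abs_le_sqrt (hC (φ m - φ n) _ ?_ (by positivity) (hbound m n N hm hn))
      exact ((hφ m).union (hφ n)).subset (Function.support_sub _ _)
    · simpa only [mul_zero, Real.sqrt_zero] using (hlim4.const_mul C).sqrt
  choose g hg using hconv
  have hgE : ∀ n : ℕ, energy b c (φ n - g) ≤ ENNReal.ofReal (4 * (1 / ((n : ℝ) + 1))) := fun n =>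
    energy_le_of_tendsto (g := fun m => φ n - φ m) (fun x => (hg x).const_sub (φ n x))
      (eventually_atTop.2 ⟨n, fun m hm => hbound n m n le_rfl hm⟩)
  have hgD : MemD0 b c g := by
    refine ⟨φ, hφ, hg, ?_⟩
    refine tendsto_of_tendsto_of_tendsto_of_le_of_le tendsto_const_nhds ?_ (fun _ => zero_le) hgE
    simpa only [ENNReal.ofReal_zero] using ENNReal.tendsto_ofReal hlim4
  have hhE : energy b c (f - g) ≤ ENNReal.ofReal d := by
    have hlimd : Tendsto (fun n : ℕ => ENNReal.ofReal (d + 1 / ((n : ℝ) + 1))) atTop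
        (𝓝 (ENNReal.ofReal d)) := by
      simpa only [add_zero] using ENNReal.tendsto_ofReal (hlim1.const_add d)
    refine ge_of_tendsto' hlimd fun N => ?_
    refine energy_le_of_tendsto (g := fun n => f - φ n) (fun x => (hg x).const_sub (f x))
      (eventually_atTop.2 ⟨N, fun n hn => (hup n).trans (ENNReal.ofReal_le_ofReal ?_)⟩)
    gcongr
  have hmin : ∀ ψ : X → ℝ, FinSupp ψ → energy b c (f - g) ≤ energy b c (f - g + ψ) := by
    intro ψ hψ
    refine hhE.trans ?_
    have hstep : ∀ ε : ℝ, 0 < ε →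
        ENNReal.ofReal d ≤ ENNReal.ofReal (1 + ε) * energy b c (f - g + ψ) := by
      intro ε hε
      have ht : Tendsto (fun n : ℕ => ENNReal.ofReal (1 + ε) * energy b c (f - g + ψ)
          + ENNReal.ofReal (1 + ε⁻¹) * ENNReal.ofReal (4 * (1 / ((n : ℝ) + 1)))) atTop
          (𝓝 (ENNReal.ofReal (1 + ε) * energy b c (f - g + ψ))) := by
        have h := ENNReal.Tendsto.const_mul (a := ENNReal.ofReal (1 + ε⁻¹))
          (ENNReal.tendsto_ofReal hlim4) (Or.inr ENNReal.ofReal_ne_top)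
        simpa only [ENNReal.ofReal_zero, mul_zero, add_zero] using h.const_add _
      refine ge_of_tendsto' ht fun n => ?_
      have hsplit : f - (φ n - ψ) = (f - g + ψ) + (g - φ n) := by abel
      refine (hlow (φ n - ψ)
        (((hφ n).union hψ).subset (Function.support_sub _ _))).trans ?_
      rw [hsplit]
      refine (hG.energy_add_le _ _ hε).trans ?_
      rw [energy_sub_comm g]
      gcongr
      exact hgE n
    have ht : Tendsto (fun n : ℕ => ENNReal.ofReal (1 + 1 / ((n : ℝ) + 1))
        * energy b c (f - g + ψ)) atTop (𝓝 (energy b c (f - g + ψ))) := by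
      have h := ENNReal.Tendsto.mul_const (b := energy b c (f - g + ψ))
        (ENNReal.tendsto_ofReal (hlim1.const_add 1)) (Or.inl (by simp))
      simpa only [add_zero, ENNReal.ofReal_one, one_mul] using h
    exact ge_of_tendsto' ht fun n => hstep _ (by positivity)
  have hfin : FiniteEnergy b c (f - g) := hhE.trans_lt ENNReal.ofReal_lt_top
  exact ⟨g, hgD, hfin, hfin.memF hG, hG.formalLaplacian_eq_zero_of_forall_energy_le hfin hmin⟩

lemma MemC0.exists_abs_le {f : X → ℝ} (hf : MemC0 f) : ∃ M : ℝ, ∀ x, |f x| ≤ M := by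
  obtain ⟨M, hM⟩ := ((hf 1 one_pos).image fun x => |f x|).bddAbove
  refine ⟨max M 1, fun x => ?_⟩
  rcases le_total 1 |f x| with h | h
  · exact le_max_of_le_left (hM ⟨x, h, rfl⟩)
  · exact le_max_of_le_right h

end

end UTGraph

open UTGraph Filter Topology ENNReal in
/-- a connected graph is canonically compactifiable (every function of
finite energy is bounded) iff it is uniformly transient and every harmonic function
of finite energy is bounded. -/
theorem stmt17 {X : Type*} [Countable X] [Infinite X]
    (b : X → X → ℝ) (c : X → ℝ) (hgraph : IsGraph b c) (hconn : Connected b) :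
    (∀ f : X → ℝ, FiniteEnergy b c f → ∃ M : ℝ, ∀ x, |f x| ≤ M) ↔
      (UniformlyTransient b c ∧
        ∀ f : X → ℝ, FiniteEnergy b c f → Harmonic b c f →
          ∃ M : ℝ, ∀ x, |f x| ≤ M) := by
  refine ⟨fun hbd => ⟨hgraph.uniformlyTransient_of_bounded hconn hbd, fun f hf _ => hbd f hf⟩, ?_⟩
  rintro ⟨hUT, hharm⟩ f hf
  obtain ⟨g, hg, hfin, hh⟩ := hgraph.exists_royden_decomposition hconn hUT hf
  obtain ⟨M, hM⟩ := (hUT g hg).exists_abs_le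
  obtain ⟨N, hN⟩ := hharm _ hfin hh
  refine ⟨N + M, fun x => ?_⟩
  calc |f x| = |(f - g) x + g x| := by simp
    _ ≤ |(f - g) x| + |g x| := abs_add_le _ _
    _ ≤ N + M := add_le_add (hN x) (hM x)
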